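/- arXiv:1108.5975 — 5 statements merged into one kernel-verified Lean document; each statement's English description precedes it below -/
import Mathlib

section
/- Let n ≥ 1 and let ω ∈ ℝⁿ have rationally independent components. Let G : 𝕋ⁿ → 𝕋ⁿ be a continuous map satisfying G(φ − π(tω)) = G(φ) + π(tω) for all φ ∈ 𝕋ⁿ and all t ∈ ℝ, where π : ℝⁿ → 𝕋ⁿ is the canonical projection (this expresses that G reverses the flow of the constant vector field ω). Then there exists Δ ∈ 𝕋ⁿ such that G(φ) = Δ − φ for all φ ∈ 𝕋ⁿ; in particular, G ∘ G is the identity map, i.e., G is an involution. -/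
namespace UnitAddTorus

variable {d : Type*} [Fintype d]

lemma mFourier_apply_add (k : d → ℤ) (x y : UnitAddTorus d) :
    mFourier k (x + y) = mFourier k x * mFourier k y := by
  simp [mFourier, fourier_apply, AddCircle.toCircle_add, Finset.prod_mul_distrib]

lemma mFourier_coe (k : d → ℤ) (v : d → ℝ) :
    mFourier k (fun i => (v i : UnitAddCircle)) =
      Complex.exp (2 * Real.pi * Complex.I * ((∑ i, k i * v i : ℝ) : ℂ)) := by
  simp only [mFourier, ContinuousMap.coe_mk, fourier_coe_apply, ← Complex.exp_sum]
  congr 1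
  push_cast
  rw [Finset.mul_sum]
  exact Finset.sum_congr rfl fun i _ => by ring

lemma mFourierCoeff_eq_mul_of_add_right_eq {f : UnitAddTorus d → ℂ} {a : UnitAddTorus d}
    (hf : ∀ x, f (x + a) = f x) (k : d → ℤ) :
    mFourierCoeff f k = mFourier (-k) a * mFourierCoeff f k := by
  let _ : MeasureTheory.MeasureSpace UnitAddCircle := ⟨AddCircle.haarAddCircle⟩
  have : MeasureTheory.Measure.IsAddHaarMeasure
      (MeasureTheory.volume : MeasureTheory.Measure UnitAddCircle) :=
    inferInstanceAs (MeasureTheory.Measure.IsAddHaarMeasure AddCircle.haarAddCircle)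
  have h := MeasureTheory.integral_add_right_eq_self
    (μ := (MeasureTheory.volume : MeasureTheory.Measure (UnitAddTorus d)))
    (fun x => mFourier (-k) x • f x) a
  change _ = mFourierCoeff f k at h
  calc mFourierCoeff f k = _ := h.symm
    _ = ∫ x, mFourier (-k) a * (mFourier (-k) x • f x) := by
        congr 1
        ext x
        rw [hf, mFourier_apply_add, smul_eq_mul, smul_eq_mul]
        ring
    _ = _ := MeasureTheory.integral_const_mul _ _

/-- A continuous function on the torus that is constant along a linear flow with rationally
independent frequencies is constant. -/
theorem eq_of_forall_add_eq {ω : d → ℝ} (hω : LinearIndependent ℚ ω)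
    {f : UnitAddTorus d → ℂ} (hfc : Continuous f)
    (hf : ∀ x (t : ℝ), f (x + fun i => ((t * ω i : ℝ) : UnitAddCircle)) = f x)
    (x y : UnitAddTorus d) : f x = f y := by
  have hcoeff : ∀ k ≠ 0, mFourierCoeff f k = 0 := by
    intro k hk
    set s : ℝ := ∑ i, ((-k) i : ℝ) * ω i with hs
    have hs0 : s ≠ 0 := by
      intro h0
      apply hk
      have hq := Fintype.linearIndependent_iff.mp hω (fun i => ((-k) i : ℚ))
        (by rw [← h0, hs]; exact Finset.sum_congr rfl fun i _ => by simp [Rat.smul_def])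
      funext i
      simpa using hq i
    have h := mFourierCoeff_eq_mul_of_add_right_eq (fun x => hf x (1 / (2 * s))) k
    have hsum : ∑ i, ((-k) i : ℝ) * (1 / (2 * s) * ω i) = 1 / 2 := by
      calc _ = 1 / (2 * s) * s := by
            simp only [mul_left_comm _ (1 / (2 * s)), ← Finset.mul_sum, ← hs]
        _ = 1 / 2 := by field_simp
    have hexp : (2 * Real.pi * Complex.I * ((1 / 2 : ℝ) : ℂ)) = Real.pi * Complex.I := by
      push_cast
      ring
    rw [mFourier_coe, hsum, hexp, Complex.exp_pi_mul_I, neg_one_mul] at h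
    exact self_eq_neg.mp h
  have hconst : ∀ x, f x = mFourierCoeff f 0 := by
    intro x
    have hsum := hasSum_mFourier_series_apply_of_summable (f := ⟨f, hfc⟩)
      (summable_of_ne_finset_zero (s := {0}) fun k hk => hcoeff k (by simpa using hk)) x
    have := hsum.unique (hasSum_single 0 fun k hk => by
      rw [ContinuousMap.coe_mk, hcoeff k hk, zero_smul])
    simpa [mFourier_zero] using this
  rw [hconst x, hconst y]

end UnitAddTorus

/-- A continuous map between tori that is constant along a linear flow with rationally independent
frequencies is constant. -/
theorem AddCircle.pi_eq_of_forall_add_eq {d ι : Type*} [Fintype d] {T : ℝ} (hT : T ≠ 0) {ω : d → ℝ}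
    (hω : LinearIndependent ℚ ω) {H : (d → AddCircle T) → ι → AddCircle T} (hHc : Continuous H)
    (hH : ∀ x (t : ℝ), H (x + fun i => ((t * ω i : ℝ) : AddCircle T)) = H x)
    (x y : d → AddCircle T) : H x = H y := by
  let e := AddCircle.homeomorphAddCircle 1 T one_ne_zero hT
  have he : ∀ a b, e (a + b) = e a + e b :=
    map_add (AddCircle.equivAddCircle 1 T one_ne_zero hT)
  funext j
  have key := UnitAddTorus.eq_of_forall_add_eq hω
    (f := fun z => (AddCircle.toCircle (H (fun i => e (z i)) j) : ℂ))
    (continuous_subtype_val.comp (AddCircle.continuous_toCircle.comp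
      ((continuous_apply j).comp (hHc.comp (by fun_prop)))))
    (fun z t => by
      have harg : (fun i => e ((z + fun i => ((t * ω i : ℝ) : UnitAddCircle)) i)) =
          (fun i => e (z i)) + fun i => ((T * t * ω i : ℝ) : AddCircle T) := by
        funext i
        rw [Pi.add_apply, Pi.add_apply, he]
        congr 1
        rw [AddCircle.homeomorphAddCircle_apply_mk]
        congr 1
        ring
      simp only [harg, hH])
    (fun i => e.symm (x i)) (fun i => e.symm (y i))
  simp only [Homeomorph.apply_symm_apply] at key
  exact AddCircle.injective_toCircle hT (Circle.coe_injective key)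


/-- If a continuous map `G` of the torus `𝕋ⁿ = (ℝ/2πℤ)ⁿ` reverses the quasi-periodic flow
`φ ↦ φ + π(tω)` with rationally independent frequencies `ω`, then `G` is of the form
`φ ↦ Δ − φ`; in particular `G` is an involution. -/
theorem stmt_0 (n : ℕ) (hn : 1 ≤ n) (ω : Fin n → ℝ)
    (hω : LinearIndependent ℚ ω)
    (G : (Fin n → AddCircle (2 * Real.pi)) → (Fin n → AddCircle (2 * Real.pi)))
    (hG : Continuous G)
    (hrev : ∀ (φ : Fin n → AddCircle (2 * Real.pi)) (t : ℝ),
      G (φ - fun l => ((t * ω l : ℝ) : AddCircle (2 * Real.pi)))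
        = G φ + fun l => ((t * ω l : ℝ) : AddCircle (2 * Real.pi))) :
    ∃ Δ : Fin n → AddCircle (2 * Real.pi),
      (∀ φ, G φ = Δ - φ) ∧ G ∘ G = id := by
  have hconst := AddCircle.pi_eq_of_forall_add_eq Real.two_pi_pos.ne' hω
    (H := fun φ => G φ + φ) (hG.add continuous_id) (fun φ t => by
      have h := hrev (φ + fun l => ((t * ω l : ℝ) : AddCircle (2 * Real.pi))) t
      rw [add_sub_cancel_right] at h
      simp only [h]
      abel)
  have hΔ : ∀ φ, G φ = G 0 - φ := fun φ => by
    rw [eq_sub_iff_add_eq]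
    simpa using hconst φ 0
  refine ⟨G 0, hΔ, funext fun φ => ?_⟩
  rw [Function.comp_apply, hΔ (G φ), hΔ φ, sub_sub_cancel, id]
end

section
/- Let a ∈ ℝ with a ≠ 0 and |a| ≠ 1, and let f : ℝ → ℝ be continuous, differentiable at 0, and satisfy f(a·w) = a·f(w) for all w ∈ ℝ. Then f is linear: f(w) = f′(0)·w for all w ∈ ℝ. (This shows that the vector fields on ℝ equivariant with respect to the non-involutive linear diffeomorphism G(w) = a·w are exactly the linear vector fields.) -/
open Filter Topology in
/-- A function that is differentiable at `0` and commutes with a contracting homothety is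
linear. -/
theorem eq_deriv_mul_of_commute_contraction {b : ℝ} (hb : b ≠ 0) (hb1 : |b| < 1) {f : ℝ → ℝ}
    (hdiff : DifferentiableAt ℝ f 0) (heq : ∀ w : ℝ, f (b * w) = b * f w) (w : ℝ) :
    f w = deriv f 0 * w := by
  have hf0 : f 0 = 0 := by
    have h := heq 0
    rw [mul_zero] at h
    have hne : 1 - b ≠ 0 := sub_ne_zero.2 (lt_of_abs_lt hb1).ne'
    exact (mul_eq_zero.1 (by linarith : (1 - b) * f 0 = 0)).resolve_left hne
  rcases eq_or_ne w 0 with rfl | hw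
  · simp [hf0]
  have hpow (n : ℕ) : f (b ^ n * w) = b ^ n * f w := by
    induction n with
    | zero => simp
    | succ n ih => rw [pow_succ', mul_assoc, heq, ih, mul_assoc]
  have hlim : Tendsto (fun n : ℕ => b ^ n * w) atTop (𝓝[≠] 0) := by
    refine tendsto_nhdsWithin_iff.2 ⟨?_, .of_forall fun n => mul_ne_zero (pow_ne_zero n hb) hw⟩
    simpa using (tendsto_pow_atTop_nhds_zero_of_abs_lt_one hb1).mul_const w
  have hslope := (hasDerivAt_iff_tendsto_slope.1 hdiff.hasDerivAt).comp hlim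
  have hconst : slope f 0 ∘ (fun n : ℕ => b ^ n * w) = fun _ => f w / w := by
    funext n
    simp only [Function.comp_apply, slope_def_field, hf0, hpow, sub_zero]
    exact mul_div_mul_left _ _ (pow_ne_zero n hb)
  rw [hconst] at hslope
  rw [← tendsto_nhds_unique tendsto_const_nhds hslope, div_mul_cancel₀ _ hw]

/-- A continuous vector field on `ℝ`, differentiable at `0`, that is equivariant with respect
to the non-involutive linear diffeomorphism `w ↦ a·w` (`a ≠ 0`, `|a| ≠ 1`) is linear. -/
theorem stmt_8 (a : ℝ) (ha : a ≠ 0) (ha1 : |a| ≠ 1) (f : ℝ → ℝ)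
    (hf : Continuous f) (hdiff : DifferentiableAt ℝ f 0)
    (heq : ∀ w : ℝ, f (a * w) = a * f w) :
    ∀ w : ℝ, f w = deriv f 0 * w := by
  rcases ha1.lt_or_gt with hlt | hgt
  · exact eq_deriv_mul_of_commute_contraction ha hlt hdiff heq
  · refine eq_deriv_mul_of_commute_contraction (inv_ne_zero ha) ?_ hdiff fun w => ?_
    · rw [abs_inv]
      exact inv_lt_one_of_one_lt₀ hgt
    · rw [eq_inv_mul_iff_mul_eq₀ ha, ← heq, mul_inv_cancel_left₀ ha]
end

section
/- Let a ∈ ℝ with a ≠ 0 and |a| ≠ 1, and let f : ℝ → ℝ be continuous, differentiable at 0, and satisfy f(a·w) = −a·f(w) for all w ∈ ℝ. Then f is identically zero. (This shows that the only vector field on ℝ reversible with respect to the non-involutive linear diffeomorphism G(w) = a·w is the zero field, so the decomposition of Lemma on involutions fails for non-involutive G.) -/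
open Filter Topology in
/-- The case of a contraction: a function differentiable at `0` with `f (b * w) = -(b * f w)`
and `0 < |b| < 1` vanishes identically. -/
theorem eq_zero_of_map_mul_eq_neg_of_abs_lt_one {b : ℝ} (hb : b ≠ 0) (hb1 : |b| < 1) {f : ℝ → ℝ}
    (hdiff : DifferentiableAt ℝ f 0) (heq : ∀ w : ℝ, f (b * w) = -(b * f w)) (w : ℝ) :
    f w = 0 := by
  have hf0 : f 0 = 0 := by
    have h : (1 + b) * f 0 = 0 := by
      have := heq 0
      rw [mul_zero] at this
      linarith
    refine (mul_eq_zero.mp h).resolve_left fun h1 => ?_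
    linarith [(abs_lt.mp hb1).1]
  rcases eq_or_ne w 0 with rfl | hw
  · exact hf0
  have hiter : ∀ n : ℕ, slope f 0 (b ^ n * w) = (-1) ^ n * (f w / w) := by
    have hpow : ∀ n : ℕ, f (b ^ n * w) = (-1) ^ n * b ^ n * f w := by
      intro n
      induction n with
      | zero => simp
      | succ k ih => rw [pow_succ', mul_assoc, heq, ih]; ring
    intro n
    have hbn : b ^ n ≠ 0 := pow_ne_zero n hb
    rw [slope_def_field, hf0, hpow, sub_zero, sub_zero]
    field_simp
  have hpt : Tendsto (fun n : ℕ => b ^ n * w) atTop (𝓝[≠] 0) := by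
    refine tendsto_nhdsWithin_iff.mpr ⟨?_, Eventually.of_forall fun n => ?_⟩
    · simpa using (tendsto_pow_atTop_nhds_zero_of_abs_lt_one hb1).mul_const w
    · exact mul_ne_zero (pow_ne_zero n hb) hw
  have hlim : Tendsto (fun n : ℕ => (-1) ^ n * (f w / w)) atTop (𝓝 (deriv f 0)) :=
    ((hasDerivAt_iff_tendsto_slope.mp hdiff.hasDerivAt).comp hpt).congr hiter
  have hneg : Tendsto (fun n : ℕ => (-1) ^ n * (f w / w)) atTop (𝓝 (-deriv f 0)) :=
    ((tendsto_add_atTop_iff_nat 1).mpr hlim).neg.congr fun n => by ring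
  have hzero : deriv f 0 = 0 := by linarith [tendsto_nhds_unique hlim hneg]
  have habs : Tendsto (fun _ : ℕ => |f w / w|) atTop (𝓝 |deriv f 0|) :=
    hlim.abs.congr fun n => by simp [abs_mul]
  have hquot : |f w / w| = 0 := by
    simpa [hzero] using tendsto_nhds_unique tendsto_const_nhds habs
  exact (div_eq_zero_iff.mp (abs_eq_zero.mp hquot)).resolve_right hw

/-- The only continuous vector field on `ℝ`, differentiable at `0`, that is reversible with
respect to the non-involutive linear diffeomorphism `w ↦ a·w` (`a ≠ 0`, `|a| ≠ 1`) is the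
zero field. -/
theorem stmt_9 (a : ℝ) (ha : a ≠ 0) (ha1 : |a| ≠ 1) (f : ℝ → ℝ)
    (hf : Continuous f) (hdiff : DifferentiableAt ℝ f 0)
    (heq : ∀ w : ℝ, f (a * w) = -(a * f w)) :
    ∀ w : ℝ, f w = 0 := by
  rcases lt_or_gt_of_ne ha1 with h | h
  · exact eq_zero_of_map_mul_eq_neg_of_abs_lt_one ha h hdiff heq
  · refine eq_zero_of_map_mul_eq_neg_of_abs_lt_one (inv_ne_zero ha) ?_ hdiff fun w => ?_
    · rw [abs_inv]
      exact inv_lt_one_of_one_lt₀ h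
    · have := heq (a⁻¹ * w)
      rw [mul_inv_cancel_left₀ ha] at this
      rw [this]
      field_simp
end

section
/- Let α, β ∈ ℝ and let M be the 4 × 4 real matrix with rows (0, α, 0, β), (α, 0, β, 0), (0, −β, 0, α), (−β, 0, α, 0). Then the set of complex eigenvalues of M is exactly {α + iβ, α − iβ, −α + iβ, −α − iβ}. -/
open Complex in
/-- The complex eigenvalues of the 4×4 matrix with rows `(0, α, 0, β)`, `(α, 0, β, 0)`,
`(0, −β, 0, α)`, `(−β, 0, α, 0)` are exactly `±α ± iβ`. -/
theorem stmt_12 (α β : ℝ) :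
    spectrum ℂ
      ((!![0, α, 0, β;
           α, 0, β, 0;
           0, -β, 0, α;
           -β, 0, α, 0] : Matrix (Fin 4) (Fin 4) ℝ).map (algebraMap ℝ ℂ))
      = {(α : ℂ) + (β : ℂ) * I, (α : ℂ) - (β : ℂ) * I,
         -(α : ℂ) + (β : ℂ) * I, -(α : ℂ) - (β : ℂ) * I} := by
  ext z
  have hdet : (Matrix.scalar (Fin 4) z - (!![0, α, 0, β;
           α, 0, β, 0;
           0, -β, 0, α;
           -β, 0, α, 0] : Matrix (Fin 4) (Fin 4) ℝ).map (algebraMap ℝ ℂ)).det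
      = (z - (α + β * I)) * (z - (α - β * I)) * (z - (-α + β * I)) * (z - (-α - β * I)) := by
    simp [Matrix.det_succ_row_zero, Fin.sum_univ_succ, Fin.succAbove, Matrix.diagonal_apply]
    linear_combination (β ^ 2 * (2 * z ^ 2 + 2 * α ^ 2) - β ^ 4 * (I ^ 2 - 1)) * I_sq
  rw [Matrix.mem_spectrum_iff_isRoot_charpoly, Polynomial.IsRoot.def, Matrix.eval_charpoly, hdet]
  simp only [mul_eq_zero, sub_eq_zero, Set.mem_insert_iff, Set.mem_singleton_iff, or_assoc]
end

section
/- Let n ≥ 1, let ω ∈ ℝⁿ have rationally independent components, and let f : ℝⁿ → ℝ be continuous, 2π-periodic in each coordinate (f(x + 2π eₗ) = f(x) for all x and each standard basis vector eₗ), and differentiable everywhere with Df(x)(ω) = 0 for all x ∈ ℝⁿ. Then f is constant. -/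
open MeasureTheory UnitAddTorus

/-- The normalised Haar measure on `ℝ / ℤ`, as used by `UnitAddTorus.mFourierCoeff`. -/
noncomputable local instance : MeasureSpace UnitAddCircle := ⟨AddCircle.haarAddCircle⟩

local instance : Measure.IsAddHaarMeasure (volume : Measure UnitAddCircle) :=
  inferInstanceAs (Measure.IsAddHaarMeasure AddCircle.haarAddCircle)

theorem UnitAddTorus.mFourier_apply_add_s17 {d : Type*} [Fintype d] (k : d → ℤ)
    (x y : UnitAddTorus d) : mFourier k (x + y) = mFourier k x * mFourier k y := by
  simp only [mFourier, ContinuousMap.coe_mk, Pi.add_apply, ← Finset.prod_mul_distrib]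
  refine Finset.prod_congr rfl fun i _ => ?_
  simp only [fourier_apply, smul_add, AddCircle.toCircle_add, Circle.coe_mul]

theorem UnitAddTorus.mFourier_coe_apply {d : Type*} [Fintype d] (k : d → ℤ) (x : d → ℝ) :
    mFourier k (fun i => (x i : UnitAddCircle)) =
      Complex.exp (2 * Real.pi * Complex.I * ((∑ i, k i * x i : ℝ) : ℂ)) := by
  simp only [mFourier, ContinuousMap.coe_mk, fourier_coe_apply, ← Complex.exp_sum]
  push_cast
  rw [Finset.mul_sum]
  congr 1
  refine Finset.sum_congr rfl fun i _ => ?_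
  ring

/-- A Fourier coefficient of a function invariant under a translation vanishes when the
corresponding character is nontrivial on that translation. -/
theorem UnitAddTorus.mFourierCoeff_eq_zero_of_add_right {d : Type*} [Fintype d]
    {E : Type*} [NormedAddCommGroup E] [NormedSpace ℂ E] {F : UnitAddTorus d → E}
    {s : UnitAddTorus d} (hF : ∀ x, F (x + s) = F x) {k : d → ℤ} (hk : mFourier (-k) s ≠ 1) :
    mFourierCoeff F k = 0 := by
  have h : mFourierCoeff F k = mFourier (-k) s • mFourierCoeff F k := by
    calc mFourierCoeff F k = ∫ t, mFourier (-k) (t + s) • F (t + s) :=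
          (integral_add_right_eq_self (fun t => mFourier (-k) t • F t) s).symm
      _ = ∫ t, mFourier (-k) s • (mFourier (-k) t • F t) := by
          simp only [hF, mFourier_apply_add_s17, smul_smul, mul_comm]
      _ = mFourier (-k) s • mFourierCoeff F k := integral_smul _ _
  have h' : (1 - mFourier (-k) s) • mFourierCoeff F k = 0 := by
    rw [sub_smul, one_smul, ← h, sub_self]
  exact (smul_eq_zero.mp h').resolve_left (sub_ne_zero.mpr hk.symm)

/-- A continuous function on the torus whose nonzero frequencies all vanish is constant. -/
theorem UnitAddTorus.eq_const_of_mFourierCoeff_eq_zero {d : Type*} [Fintype d]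
    (F : C(UnitAddTorus d, ℂ)) (hF : ∀ k ≠ 0, mFourierCoeff F k = 0) (x : UnitAddTorus d) :
    F x = mFourierCoeff F 0 := by
  have hsum : Summable (mFourierCoeff F) :=
    summable_of_ne_finset_zero (s := {0}) fun k hk => hF k (by simpa using hk)
  have h := hasSum_mFourier_series_apply_of_summable hsum x
  have h0 := hasSum_single (f := fun k => mFourierCoeff F k • mFourier k x) 0
    fun k hk => by simp [hF k hk]
  simpa [mFourier_zero] using h.unique h0

theorem isOpenQuotientMap_coe_unitAddTorus (d : Type*) :
    IsOpenQuotientMap (fun (x : d → ℝ) i => (x i : UnitAddCircle)) :=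
  IsOpenQuotientMap.piMap fun _ : d => QuotientAddGroup.isOpenQuotientMap_mk

/-- A function periodic in each coordinate is invariant under the lattice of periods. -/
theorem apply_add_int_mul_of_periodic {n : ℕ} {α : Type*} {f : (Fin n → ℝ) → α} {T : ℝ}
    (hper : ∀ (x : Fin n → ℝ) (l : Fin n), f (x + Pi.single l T) = f x)
    (x : Fin n → ℝ) (m : Fin n → ℤ) : f (x + fun i => m i * T) = f x := by
  have key : ∀ s : Finset (Fin n), Function.Periodic f (∑ l ∈ s, m l • Pi.single l T) := by
    intro s
    induction s using Finset.induction_on with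
    | empty => intro x; simp
    | insert a s ha ih =>
      rw [Finset.sum_insert ha]
      have hp : Function.Periodic f (Pi.single a T) := fun x => hper x a
      exact (hp.zsmul (m a)).add_period ih
  have h : (fun i => m i * T) = ∑ l, m l • (Pi.single l T : Fin n → ℝ) := by
    ext i
    simp [Finset.sum_apply, Pi.single_apply]
  rw [h]
  exact key Finset.univ x

theorem apply_add_smul_of_fderiv_eq_zero {E G : Type*} [NormedAddCommGroup E] [NormedSpace ℝ E]
    [NormedAddCommGroup G] [NormedSpace ℝ G] {f : E → G}
    {v : E} (hdiff : Differentiable ℝ f) (hder : ∀ x, fderiv ℝ f x v = 0) (x : E) (t : ℝ) :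
    f (x + t • v) = f x := by
  have hd : ∀ s : ℝ, HasDerivAt (fun s : ℝ => f (x + s • v)) 0 s := fun s => by
    have h1 : HasDerivAt (fun s : ℝ => x + s • v) v s := by
      simpa using ((hasDerivAt_id s).smul_const v).const_add x
    have h2 := (hdiff (x + s • v)).hasFDerivAt.comp_hasDerivAt s h1
    rwa [hder] at h2
  simpa using is_const_of_deriv_eq_zero (fun s => (hd s).differentiableAt)
    (fun s => (hd s).deriv) t 0

theorem LinearIndependent.sum_intCast_mul_ne_zero {ι : Type*} [Fintype ι] {ω : ι → ℝ}
    (hω : LinearIndependent ℚ ω) {k : ι → ℤ} (hk : k ≠ 0) : ∑ i, (k i : ℝ) * ω i ≠ 0 := by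
  intro h
  refine hk (funext fun i => ?_)
  have := Fintype.linearIndependent_iff.mp hω (fun i => (k i : ℚ))
    (by simpa [Rat.smul_def] using h) i
  exact_mod_cast this

/-- A continuous function on `ℝⁿ`, `2π`-periodic in each coordinate and differentiable with
vanishing derivative in a rationally independent direction `ω`, is constant. -/
theorem stmt_17 (n : ℕ) (hn : 1 ≤ n) (ω : Fin n → ℝ) (hω : LinearIndependent ℚ ω)
    (f : (Fin n → ℝ) → ℝ) (hf : Continuous f)
    (hper : ∀ (x : Fin n → ℝ) (l : Fin n), f (x + Pi.single l (2 * Real.pi)) = f x)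
    (hdiff : Differentiable ℝ f)
    (hder : ∀ x : Fin n → ℝ, fderiv ℝ f x ω = 0) :
    ∀ x y : Fin n → ℝ, f x = f y := by
  have hq := isOpenQuotientMap_coe_unitAddTorus (Fin n)
  let q : C(Fin n → ℝ, UnitAddTorus (Fin n)) := ⟨_, hq.continuous⟩
  have hquot : Topology.IsQuotientMap q := hq.isQuotientMap
  let g : C(Fin n → ℝ, ℂ) := ⟨fun x => (f ((2 * Real.pi) • x) : ℂ), by fun_prop⟩
  have hg : Function.FactorsThrough g q := by
    intro a b hab
    have hab' : ∀ i, ∃ m : ℤ, a i = b i + m := fun i => by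
      have h0 : ((a i - b i : ℝ) : UnitAddCircle) = 0 := by
        rw [AddCircle.coe_sub, sub_eq_zero]
        exact congrFun hab i
      obtain ⟨m, hm⟩ := AddCircle.coe_eq_zero_iff 1 |>.mp h0
      rw [zsmul_one] at hm
      exact ⟨m, by rw [hm]; ring⟩
    choose m hm using hab'
    have : (2 * Real.pi) • a = (2 * Real.pi) • b + fun i => m i * (2 * Real.pi) := by
      ext i
      simp only [Pi.smul_apply, Pi.add_apply, smul_eq_mul, hm i]
      ring
    simp only [g, ContinuousMap.coe_mk, this, apply_add_int_mul_of_periodic hper]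
  let F : C(UnitAddTorus (Fin n), ℂ) := hquot.lift g hg
  have hFq : ∀ x, F (q x) = g x := fun x => DFunLike.congr_fun (hquot.lift_comp g hg) x
  have hinv : ∀ (t : ℝ) (x : UnitAddTorus (Fin n)), F (x + q (t • ω)) = F x := by
    intro t x
    obtain ⟨x, rfl⟩ := hquot.surjective x
    have hadd : q x + q (t • ω) = q (x + t • ω) := rfl
    rw [hadd, hFq, hFq]
    simp only [g, ContinuousMap.coe_mk, smul_add, smul_smul]
    rw [apply_add_smul_of_fderiv_eq_zero hdiff hder]
  have hcoeff : ∀ k ≠ 0, mFourierCoeff F k = 0 := by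
    intro k hk
    have hS := hω.sum_intCast_mul_ne_zero (neg_ne_zero.mpr hk)
    set S := ∑ i, ((-k) i : ℝ) * ω i
    refine mFourierCoeff_eq_zero_of_add_right (hinv (1 / (2 * S))) ?_
    have hsum : ∑ i, ((-k) i : ℝ) * ((1 / (2 * S)) • ω) i = 1 / 2 := by
      have : ∑ i, ((-k) i : ℝ) * ((1 / (2 * S)) • ω) i = 1 / (2 * S) * S := by
        refine Eq.trans ?_ (Finset.mul_sum _ _ _).symm
        refine Finset.sum_congr rfl fun i _ => ?_
        simp only [Pi.smul_apply, smul_eq_mul]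
        ring
      rw [this]
      field_simp
    have hval : mFourier (-k) (q ((1 / (2 * S)) • ω)) = -1 := by
      refine (mFourier_coe_apply (-k) ((1 / (2 * S)) • ω)).trans ?_
      rw [hsum, ← Complex.exp_pi_mul_I]
      congr 1
      push_cast
      ring
    rw [hval]
    norm_num
  have hconst : ∀ x, (f x : ℂ) = mFourierCoeff F 0 := by
    intro x
    rw [← eq_const_of_mFourierCoeff_eq_zero F hcoeff (q ((2 * Real.pi)⁻¹ • x)), hFq]
    simp only [g, ContinuousMap.coe_mk, smul_inv_smul₀ Real.two_pi_pos.ne']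
  intro x y
  exact_mod_cast (hconst x).trans (hconst y).symm
end
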